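/- Let d ≥ 1, let p ∈ ℕ, and let C ⊆ ℝ^d be a closed convex cone with C ≠ {0}. Let κ : ℝ → ℂ be of class C^p and integrable on [0, +∞). For i = 1, …, n let m_i ∈ ℤ and let P_i = conv(F_i) + cone(G_i), where F_i ⊆ ℝ^d is finite nonempty, G_i ⊆ ℝ^d is finite, cone(G_i) = {Σ_{g∈G_i} λ_g g : λ_g ≥ 0} and cone(G_i) ⊆ C. Define, for ξ in the topological interior of the dual cone C*, T(ξ) = Σ_{i=1}^n m_i · ∫_ℝ κ(t) · 1_{{t : −h_{P_i}(−ξ) ≤ t and t ≤ h_{P_i}(ξ)}}(t) dt, where support functions take values in ℝ ∪ {+∞} and an inequality against +∞ is vacuous. Then there exists a finite family Γ_1, …, Γ_m of open convex polyhedral cones of ℝ^d such that ℝ^d = ⋃_{j=1}^m closure(Γ_j) and, for each j, the restriction of T to Γ_j ∩ Int(C*) is of class C^{p+1}. -/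

import Mathlib

open MeasureTheory Filter Set
open scoped RealInnerProductSpace Topology Pointwise

noncomputable section

/-- The support function of a set `A ⊆ ℝ^d`, with values in `ℝ ∪ {±∞}`:
`h_A(ξ) = sup_{x ∈ A} ⟪ξ, x⟫`. -/
def suppFn {d : ℕ} (A : Set (EuclideanSpace ℝ (Fin d)))
    (ξ : EuclideanSpace ℝ (Fin d)) : EReal :=
  ⨆ x ∈ A, ((⟪ξ, x⟫ : ℝ) : EReal)

/-- An open convex polyhedral cone in `ℝ^d`: an intersection of finitely many open
half-spaces `{x | ⟪u, x⟫ > 0}` with `u ≠ 0` (the empty intersection being `ℝ^d`). -/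
def IsOpenPolyhedralCone {d : ℕ} (Γ : Set (EuclideanSpace ℝ (Fin d))) : Prop :=
  ∃ s : Finset (EuclideanSpace ℝ (Fin d)),
    (0 : EuclideanSpace ℝ (Fin d)) ∉ s ∧
    Γ = ⋂ u ∈ s, {x : EuclideanSpace ℝ (Fin d) | 0 < ⟪u, x⟫}

/-- The conical hull `cone(G) = {Σ_{g ∈ G} λ_g • g : λ_g ≥ 0}` of a finite set `G`. -/
def finConeOf {d : ℕ} (G : Finset (EuclideanSpace ℝ (Fin d))) :
    Set (EuclideanSpace ℝ (Fin d)) :=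
  {x | ∃ lam : EuclideanSpace ℝ (Fin d) → ℝ,
    (∀ g, 0 ≤ lam g) ∧ x = ∑ g ∈ G, lam g • g}

section SupportFunction

variable {d : ℕ}

theorem suppFn_eq_of_isMaxOn {A : Set (EuclideanSpace ℝ (Fin d))}
    {ξ f : EuclideanSpace ℝ (Fin d)} (hf : f ∈ A) (hmax : ∀ x ∈ A, ⟪ξ, x⟫ ≤ ⟪ξ, f⟫) :
    suppFn A ξ = ((⟪ξ, f⟫ : ℝ) : EReal) := by
  apply le_antisymm
  · exact iSup₂_le fun x hx => EReal.coe_le_coe_iff.2 (hmax x hx)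
  · exact le_iSup₂ (f := fun x (_ : x ∈ A) => ((⟪ξ, x⟫ : ℝ) : EReal)) f hf

theorem suppFn_eq_top_of_ray {A : Set (EuclideanSpace ℝ (Fin d))}
    {ξ f g : EuclideanSpace ℝ (Fin d)} (hray : ∀ t : ℝ, 0 ≤ t → f + t • g ∈ A)
    (hg : 0 < ⟪ξ, g⟫) : suppFn A ξ = ⊤ := by
  rw [EReal.eq_top_iff_forall_lt]
  intro y
  have hmem := hray (max 0 ((y + 1 - ⟪ξ, f⟫) / ⟪ξ, g⟫)) (le_max_left _ _)
  refine lt_of_lt_of_le (EReal.coe_lt_coe_iff.2 ?_)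
    (le_iSup₂ (f := fun x (_ : x ∈ A) => ((⟪ξ, x⟫ : ℝ) : EReal)) _ hmem)
  rw [inner_add_right, inner_smul_right]
  have h : (y + 1 - ⟪ξ, f⟫) ≤ max 0 ((y + 1 - ⟪ξ, f⟫) / ⟪ξ, g⟫) * ⟪ξ, g⟫ := by
    rw [← div_le_iff₀ hg]
    exact le_max_right _ _
  linarith

theorem smul_mem_finConeOf {G : Finset (EuclideanSpace ℝ (Fin d))}
    {g : EuclideanSpace ℝ (Fin d)} (hg : g ∈ G) {t : ℝ} (ht : 0 ≤ t) :
    t • g ∈ finConeOf G := by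
  classical
  refine ⟨fun x => if x = g then t else 0, fun x => ?_, ?_⟩
  · dsimp only
    split_ifs <;> simp [ht]
  · simp [ite_smul, hg]

theorem zero_mem_finConeOf (G : Finset (EuclideanSpace ℝ (Fin d))) :
    (0 : EuclideanSpace ℝ (Fin d)) ∈ finConeOf G :=
  ⟨fun _ => 0, fun _ => le_rfl, by simp⟩

theorem le_inner_of_mem_convexHull {s : Set (EuclideanSpace ℝ (Fin d))}
    {ξ y : EuclideanSpace ℝ (Fin d)} {a : ℝ} (h : ∀ x ∈ s, a ≤ ⟪ξ, x⟫)
    (hy : y ∈ convexHull ℝ s) : a ≤ ⟪ξ, y⟫ :=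
  convexHull_min (t := {x | a ≤ ⟪ξ, x⟫}) h
    (convex_halfSpace_ge (innerSL ℝ ξ).toLinearMap.isLinear a) hy

theorem inner_pos_of_mem_interior_dual {C : Set (EuclideanSpace ℝ (Fin d))}
    {ξ g : EuclideanSpace ℝ (Fin d)}
    (hξ : ξ ∈ interior {y : EuclideanSpace ℝ (Fin d) | ∀ x ∈ C, 0 ≤ ⟪y, x⟫})
    (hg : g ∈ C) (hg0 : g ≠ 0) : 0 < ⟪ξ, g⟫ := by
  have hcont : Tendsto (fun t : ℝ => ξ - t • g) (𝓝[>] 0) (𝓝 ξ) := by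
    have : Continuous fun t : ℝ => ξ - t • g := by fun_prop
    simpa using (this.tendsto 0).mono_left nhdsWithin_le_nhds
  obtain ⟨t, ht, ht0⟩ :=
    ((hcont.eventually (mem_interior_iff_mem_nhds.1 hξ)).and self_mem_nhdsWithin).exists
  have h := ht g hg
  rw [inner_sub_left, real_inner_smul_left] at h
  have := mul_pos ht0 (real_inner_self_pos.2 hg0)
  linarith

end SupportFunction

section Arrangement

variable {d : ℕ}

theorem dense_setOf_forall_inner_ne_zero (S : Finset (EuclideanSpace ℝ (Fin d)))
    (hS : (0 : EuclideanSpace ℝ (Fin d)) ∉ S) :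
    Dense {x : EuclideanSpace ℝ (Fin d) | ∀ u ∈ S, ⟪u, x⟫ ≠ 0} := by
  have h : Dense (⋂ u ∈ (S : Set (EuclideanSpace ℝ (Fin d))),
      {x : EuclideanSpace ℝ (Fin d) | ⟪u, x⟫ ≠ 0}) := by
    refine dense_biInter_of_isOpen (fun u _ => ?_) S.countable_toSet fun u hu => ?_
    · exact isOpen_ne_fun (by fun_prop) continuous_const
    · have hu0 : u ≠ 0 := fun h => hS (h ▸ hu)
      intro x
      by_cases hx : ⟪u, x⟫ = 0
      · have hcont : Tendsto (fun t : ℝ => x + t • u) (𝓝[>] 0) (𝓝 x) := by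
          have : Continuous fun t : ℝ => x + t • u := by fun_prop
          simpa using (this.tendsto 0).mono_left nhdsWithin_le_nhds
        refine mem_closure_of_tendsto hcont ?_
        filter_upwards [self_mem_nhdsWithin] with t ht
        have := mul_pos ht (real_inner_self_pos.2 hu0)
        simp only [inner_add_right, inner_smul_right, hx, zero_add]
        exact this.ne'
      · exact subset_closure hx
  convert h using 1
  ext x
  simp

/-- The closed chambers of a finite hyperplane arrangement cover the space. -/
theorem exists_openPolyhedralCone_cover (S : Finset (EuclideanSpace ℝ (Fin d)))
    (hS : (0 : EuclideanSpace ℝ (Fin d)) ∉ S) :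
    ∃ (M : ℕ) (Γ : Fin M → Set (EuclideanSpace ℝ (Fin d))),
      (∀ j, IsOpenPolyhedralCone (Γ j)) ∧ (⋃ j, closure (Γ j)) = Set.univ ∧
      ∀ j, ∀ u ∈ S, (∀ x ∈ Γ j, 0 < ⟪u, x⟫) ∨ (∀ x ∈ Γ j, ⟪u, x⟫ < 0) := by
  classical
  let N := S.powerset
  let σ : Finset (EuclideanSpace ℝ (Fin d)) → Finset (EuclideanSpace ℝ (Fin d)) :=
    fun s => s ∪ (S \ s).image fun u => -u
  let Γ : Fin N.card → Set (EuclideanSpace ℝ (Fin d)) := fun j =>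
    ⋂ u ∈ σ (N.equivFin.symm j), {x : EuclideanSpace ℝ (Fin d) | 0 < ⟪u, x⟫}
  refine ⟨N.card, Γ, fun j => ⟨_, ?_, rfl⟩, ?_, fun j u hu => ?_⟩
  · have hsub := Finset.mem_powerset.1 (N.equivFin.symm j).2
    simp only [σ, Finset.mem_union, Finset.mem_image, Finset.mem_sdiff, neg_eq_zero]
    rintro (h | ⟨u, h, rfl⟩)
    · exact hS (hsub h)
    · exact hS h.1
  · rw [← closure_iUnion_of_finite, ← dense_iff_closure_eq]
    refine (dense_setOf_forall_inner_ne_zero S hS).mono fun x hx => ?_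
    have hmem : S.filter (fun u => 0 < ⟪u, x⟫) ∈ N :=
      Finset.mem_powerset.2 (Finset.filter_subset _ _)
    refine Set.mem_iUnion.2 ⟨N.equivFin ⟨_, hmem⟩, ?_⟩
    simp only [Γ, σ, Equiv.symm_apply_apply, Set.mem_iInter, Finset.mem_union, Finset.mem_image,
      Finset.mem_sdiff, Finset.mem_filter, Set.mem_ofPred_eq]
    rintro v (h | ⟨u, ⟨hu, hneg⟩, rfl⟩)
    · exact h.2
    · rw [inner_neg_left, neg_pos]
      exact lt_of_le_of_ne (not_lt.1 fun h => hneg ⟨hu, h⟩) (hx u hu)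
  · by_cases h : u ∈ (N.equivFin.symm j : Finset (EuclideanSpace ℝ (Fin d)))
    · left
      intro x hx
      exact Set.mem_iInter₂.1 hx u (Finset.mem_union_left _ h)
    · right
      intro x hx
      have : 0 < ⟪-u, x⟫ := Set.mem_iInter₂.1 hx (-u) (Finset.mem_union_right _
        (Finset.mem_image_of_mem _ (Finset.mem_sdiff.2 ⟨hu, h⟩)))
      rwa [inner_neg_left, neg_pos] at this

/-- If no nonzero difference of points of `F` changes sign on `Γ`, then one point of `F`
minimizes every linear form in `Γ`. -/
theorem exists_forall_inner_le {F : Finset (EuclideanSpace ℝ (Fin d))} (hF : F.Nonempty)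
    {Γ : Set (EuclideanSpace ℝ (Fin d))}
    (hΓ : ∀ f ∈ F, ∀ f' ∈ F, f ≠ f' →
      (∀ x ∈ Γ, 0 < ⟪f - f', x⟫) ∨ (∀ x ∈ Γ, ⟪f - f', x⟫ < 0)) :
    ∃ a ∈ F, ∀ ξ ∈ Γ, ∀ f ∈ F, ⟪ξ, a⟫ ≤ ⟪ξ, f⟫ := by
  rcases Γ.eq_empty_or_nonempty with rfl | ⟨ξ₀, hξ₀⟩
  · obtain ⟨a, ha⟩ := hF
    exact ⟨a, ha, by simp⟩
  · obtain ⟨a, ha, hmin⟩ := F.exists_min_image (fun f => ⟪ξ₀, f⟫) hF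
    refine ⟨a, ha, fun ξ hξ f hf => ?_⟩
    rcases eq_or_ne f a with rfl | hne
    · exact le_rfl
    · rcases hΓ f hf a ha hne with h | h
      · have := h ξ hξ
        rw [inner_sub_left, real_inner_comm, real_inner_comm ξ a] at this
        linarith
      · have h1 := h ξ₀ hξ₀
        have h2 := hmin f hf
        rw [inner_sub_left, real_inner_comm, real_inner_comm ξ₀ a] at h1
        linarith

end Arrangement

theorem contDiff_primitive {p : ℕ} {κ : ℝ → ℂ} (hκ : ContDiff ℝ p κ) :
    ContDiff ℝ (p + 1) fun x => ∫ t in (0 : ℝ)..x, κ t := by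
  have hd : ∀ x, HasDerivAt (fun x => ∫ t in (0 : ℝ)..x, κ t) (κ x) x := fun x =>
    intervalIntegral.integral_hasDerivAt_right (hκ.continuous.intervalIntegrable _ _)
      (hκ.continuous.stronglyMeasurableAtFilter _ _) hκ.continuous.continuousAt
  rw [contDiff_succ_iff_deriv]
  refine ⟨fun x => (hd x).differentiableAt, by simp, ?_⟩
  rwa [funext fun x => (hd x).deriv]

theorem integral_Icc_eq_primitive_sub {κ : ℝ → ℂ} (hκ : Continuous κ) {a b : ℝ} (hab : a ≤ b) :
    ∫ t in Set.Icc a b, κ t = (∫ t in (0 : ℝ)..b, κ t) - ∫ t in (0 : ℝ)..a, κ t := by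
  rw [intervalIntegral.integral_interval_sub_left (hκ.intervalIntegrable _ _)
    (hκ.intervalIntegrable _ _), intervalIntegral.integral_of_le hab,
    integral_Icc_eq_integral_Ioc]

theorem integral_Ici_eq_sub_primitive {κ : ℝ → ℂ} (hκ : Continuous κ)
    (hint : IntegrableOn κ (Set.Ici (0 : ℝ)) volume) (a : ℝ) :
    ∫ t in Set.Ici a, κ t = (∫ t in Set.Ioi (0 : ℝ), κ t) - ∫ t in (0 : ℝ)..a, κ t := by
  have h0 : IntegrableOn κ (Set.Ioi 0) volume := hint.mono_set Set.Ioi_subset_Ici_self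
  have ha : IntegrableOn κ (Set.Ioi a) volume := by
    refine ((hκ.integrableOn_Icc (a := a) (b := 0)).union h0).mono_set fun x hx => ?_
    rcases le_or_gt x 0 with h | h
    · exact Or.inl ⟨le_of_lt hx, h⟩
    · exact Or.inr h
  rw [integral_Ici_eq_integral_Ioi, ← intervalIntegral.integral_Ioi_sub_Ioi' h0 ha]
  ring

theorem contDiffOn_integral_indicator_polyhedron {d p : ℕ}
    {C Γ : Set (EuclideanSpace ℝ (Fin d))} {κ : ℝ → ℂ} (hκ : ContDiff ℝ p κ)
    (hκint : IntegrableOn κ (Set.Ici (0 : ℝ)) volume)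
    {F G : Finset (EuclideanSpace ℝ (Fin d))} (hF : F.Nonempty) (hG : finConeOf G ⊆ C)
    (hΓ : ∀ f ∈ F, ∀ f' ∈ F, f ≠ f' →
      (∀ x ∈ Γ, 0 < ⟪f - f', x⟫) ∨ (∀ x ∈ Γ, ⟪f - f', x⟫ < 0)) :
    ContDiffOn ℝ (p + 1)
      (fun ξ : EuclideanSpace ℝ (Fin d) =>
        ∫ t, ({t : ℝ |
            -suppFn (convexHull ℝ (F : Set (EuclideanSpace ℝ (Fin d))) + finConeOf G) (-ξ)
              ≤ (t : EReal) ∧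
            (t : EReal) ≤
              suppFn (convexHull ℝ (F : Set (EuclideanSpace ℝ (Fin d))) + finConeOf G)
                ξ}).indicator κ t)
      (Γ ∩ interior {y : EuclideanSpace ℝ (Fin d) | ∀ x ∈ C, 0 ≤ ⟪y, x⟫}) := by
  have hmem : ∀ f ∈ F, ∀ z ∈ finConeOf G,
      f + z ∈ convexHull ℝ (F : Set (EuclideanSpace ℝ (Fin d))) + finConeOf G :=
    fun f hf z hz => Set.add_mem_add (subset_convexHull ℝ _ hf) hz
  obtain ⟨a, haF, ha⟩ := exists_forall_inner_le hF hΓ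
  have hlow : ∀ ξ ∈ Γ ∩ interior {y : EuclideanSpace ℝ (Fin d) | ∀ x ∈ C, 0 ≤ ⟪y, x⟫},
      -suppFn (convexHull ℝ (F : Set (EuclideanSpace ℝ (Fin d))) + finConeOf G) (-ξ)
        = ((⟪ξ, a⟫ : ℝ) : EReal) := by
    intro ξ hξ
    rw [suppFn_eq_of_isMaxOn (f := a) (by simpa using hmem a haF 0 (zero_mem_finConeOf G)),
      inner_neg_left, EReal.coe_neg, neg_neg]
    rintro _ ⟨y, hy, z, hz, rfl⟩
    have h1 := le_inner_of_mem_convexHull (ha ξ hξ.1) hy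
    have h2 := interior_subset hξ.2 z (hG hz)
    simp only [inner_neg_left, inner_add_right]
    linarith
  have hprim := contDiff_primitive hκ
  have hinner : ∀ v : EuclideanSpace ℝ (Fin d), ContDiff ℝ (p + 1)
      fun ξ : EuclideanSpace ℝ (Fin d) => ∫ t in (0 : ℝ)..⟪ξ, v⟫, κ t := fun v =>
    hprim.comp (contDiff_id.inner ℝ contDiff_const)
  by_cases hG0 : ∃ g ∈ G, g ≠ 0
  · obtain ⟨g, hgG, hg0⟩ := hG0
    refine ((contDiff_const (c := ∫ t in Set.Ioi (0 : ℝ), κ t)).sub (hinner a)).contDiffOn.congr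
      fun ξ hξ => ?_
    have hgC : g ∈ C := hG (by simpa using smul_mem_finConeOf hgG zero_le_one)
    rw [hlow ξ hξ, suppFn_eq_top_of_ray
      (fun t ht => hmem a haF _ (smul_mem_finConeOf hgG ht))
      (inner_pos_of_mem_interior_dual hξ.2 hgC hg0),
      ← integral_Ici_eq_sub_primitive hκ.continuous hκint, ← integral_indicator measurableSet_Ici]
    simp only [EReal.coe_le_coe_iff, le_top, and_true, Set.Ici]
  · push Not at hG0
    obtain ⟨b, hbF, hb⟩ := exists_forall_inner_le (Γ := -Γ) hF fun f hf f' hf' hne => by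
      rcases hΓ f hf f' hf' hne with h | h
      · exact Or.inr fun x hx => by simpa using h (-x) hx
      · exact Or.inl fun x hx => by simpa using h (-x) hx
    refine ((hinner b).sub (hinner a)).contDiffOn.congr fun ξ hξ => ?_
    have hb' : ∀ f ∈ F, ⟪ξ, f⟫ ≤ ⟪ξ, b⟫ := fun f hf => by
      simpa using hb (-ξ) (by simpa using hξ.1) f hf
    rw [hlow ξ hξ, suppFn_eq_of_isMaxOn (f := b)
      (by simpa using hmem b hbF 0 (zero_mem_finConeOf G)),
      ← integral_Icc_eq_primitive_sub hκ.continuous (hb' a haF),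
      ← integral_indicator measurableSet_Icc]
    · simp only [EReal.coe_le_coe_iff, Set.Icc]
    · rintro _ ⟨y, hy, z, ⟨lam, -, rfl⟩, rfl⟩
      have hz : ∑ g ∈ G, lam g • g = 0 :=
        Finset.sum_eq_zero fun g hg => by rw [hG0 g hg, smul_zero]
      have h := le_inner_of_mem_convexHull (hb (-ξ) (by simpa using hξ.1)) hy
      simpa [hz] using h

/-- piecewise `C^{p+1}` regularity on `Int(C*)` of the hybrid transform
with a `C^p` kernel integrable on `[0,∞)` of the PL-constructible function
`Σ mᵢ 1_{Pᵢ}`, where `Pᵢ = conv(Fᵢ) + cone(Gᵢ)` with `cone(Gᵢ) ⊆ C`. -/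
theorem hybrid_transform_regularity_on_int_dual_cone
    (d : ℕ) (hd : 1 ≤ d) (p : ℕ)
    (C : Set (EuclideanSpace ℝ (Fin d)))
    (hCne : C.Nonempty) (hCclosed : IsClosed C) (hCconvex : Convex ℝ C)
    (hCcone : ∀ t : ℝ, 0 < t → ∀ x ∈ C, t • x ∈ C)
    (hCnontriv : C ≠ {0})
    (κ : ℝ → ℂ) (hκ : ContDiff ℝ p κ)
    (hκint : IntegrableOn κ (Set.Ici (0 : ℝ)) volume)
    (n : ℕ)
    (m : Fin n → ℤ)
    (F G : Fin n → Finset (EuclideanSpace ℝ (Fin d)))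
    (hF : ∀ i, (F i).Nonempty)
    (hG : ∀ i, finConeOf (G i) ⊆ C) :
    ∃ (M : ℕ) (Γ : Fin M → Set (EuclideanSpace ℝ (Fin d))),
      (∀ j, IsOpenPolyhedralCone (Γ j)) ∧
      (⋃ j, closure (Γ j)) = Set.univ ∧
      (∀ j, ContDiffOn ℝ (p + 1)
        (fun ξ : EuclideanSpace ℝ (Fin d) =>
          ∑ i : Fin n, (m i : ℂ) *
            ∫ t, ({t : ℝ |
                -suppFn (convexHull ℝ (↑(F i) : Set (EuclideanSpace ℝ (Fin d))) + finConeOf (G i)) (-ξ)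
                  ≤ (t : EReal) ∧
                (t : EReal) ≤
                  suppFn (convexHull ℝ (↑(F i) : Set (EuclideanSpace ℝ (Fin d))) + finConeOf (G i)) ξ}).indicator κ t)
        (Γ j ∩ interior {y : EuclideanSpace ℝ (Fin d) | ∀ x ∈ C, 0 ≤ ⟪y, x⟫})) := by
  classical
  let S : Finset (EuclideanSpace ℝ (Fin d)) :=
    (Finset.univ.biUnion fun i => (F i ×ˢ F i).image fun q => q.1 - q.2).erase 0
  obtain ⟨M, Γ, hΓ, hcover, hsign⟩ := exists_openPolyhedralCone_cover S (Finset.notMem_erase _ _)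
  refine ⟨M, Γ, hΓ, hcover, fun j => ContDiffOn.sum fun i _ => contDiffOn_const.mul ?_⟩
  refine contDiffOn_integral_indicator_polyhedron hκ hκint (hF i) (hG i)
    fun f hf f' hf' hne => hsign j (f - f') ?_
  refine Finset.mem_erase.2 ⟨sub_ne_zero.2 hne, Finset.mem_biUnion.2 ⟨i, Finset.mem_univ i, ?_⟩⟩
  exact Finset.mem_image.2 ⟨(f, f'), Finset.mem_product.2 ⟨hf, hf'⟩, rfl⟩
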